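/- Let φ ∈ C_c^∞(ℝ) with supp φ ⊆ [0,∞), let ā > 0 and φ̂(λ) = ∫_ℝ e^{λt}φ(t) dt. Then for every z in the sector |arg z| < π/4, (-i)∫_{ā-i∞}^{ā+i∞} φ̂(λ) (e^{-√λ z}/√λ) dλ = 2π∫₀^∞ (tπ)^{-1/2} e^{-z²/(4t)} φ(t) dt. -/

import Mathlib

open MeasureTheory Complex

theorem differentiableOn_integral_mul_exp_neg_mul {α : Type*} [MeasurableSpace α] {μ : Measure α}
    {w : α → ℂ} {c : α → ℝ} (hc : ∀ᵐ a ∂μ, 0 ≤ c a) (hcm : AEMeasurable c μ)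
    (hw : ∀ ε : ℝ, 0 < ε → Integrable (fun a ↦ w a * cexp (-ε * c a)) μ) :
    DifferentiableOn ℂ (fun p : ℂ ↦ ∫ a, w a * cexp (-p * c a) ∂μ) {p | 0 < p.re} := by
  intro p hp
  have hp : 0 < p.re := hp
  have hexp (q : ℂ) : AEStronglyMeasurable (fun a ↦ cexp (q * c a)) μ := by
    have : AEMeasurable (fun a ↦ cexp (q * c a)) μ := by fun_prop
    exact this.aestronglyMeasurable
  have hmeas (q : ℂ) : AEStronglyMeasurable (fun a ↦ w a * cexp (-q * c a)) μ := by
    refine ((hw 1 one_pos).aestronglyMeasurable.mul (hexp (1 - q))).congr (.of_forall fun a ↦ ?_)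
    simp only [Pi.mul_apply, mul_assoc, ← Complex.exp_add]
    congr 2
    push_cast
    ring
  have hbound : Integrable (fun a ↦ (4 / p.re) * ‖w a * cexp (-(p.re / 4 : ℝ) * c a)‖) μ :=
    (hw _ (by positivity)).norm.const_mul _
  have hint : Integrable (fun a ↦ w a * cexp (-p * c a)) μ := by
    refine (hw _ hp).mono (hmeas p) (.of_forall fun a ↦ le_of_eq ?_)
    simp [Complex.norm_exp]
  refine ((hasDerivAt_integral_of_dominated_loc_of_deriv_le (𝕜 := ℂ)
    (F' := fun q a ↦ w a * (cexp (-q * c a) * (-c a))) (s := {q : ℂ | p.re / 2 < q.re})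
    ((isOpen_lt continuous_const Complex.continuous_re).mem_nhds (by simpa using hp))
    (.of_forall hmeas) hint ?_ ?_ hbound ?_).2.differentiableAt).differentiableWithinAt
  · have : AEStronglyMeasurable (fun a ↦ -(c a : ℂ)) μ := by
      have : AEMeasurable (fun a ↦ -(c a : ℂ)) μ := by fun_prop
      exact this.aestronglyMeasurable
    refine ((hmeas p).mul this).congr (.of_forall fun a ↦ ?_)
    simp only [Pi.mul_apply, mul_assoc]
  · filter_upwards [hc] with a ha q hq
    have hq : p.re / 2 < q.re := hq
    have h1 : c a * Real.exp (-(p.re / 4) * c a) ≤ 4 / p.re := by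
      rw [neg_mul, Real.exp_neg, ← div_eq_mul_inv, div_le_iff₀ (Real.exp_pos _)]
      have := Real.add_one_le_exp (p.re / 4 * c a)
      calc c a = 4 / p.re * (p.re / 4 * c a) := by field_simp
        _ ≤ _ := by gcongr; linarith
    have h2 : Real.exp (-q.re * c a) ≤
        Real.exp (-(p.re / 4) * c a) * Real.exp (-(p.re / 4) * c a) := by
      rw [← Real.exp_add]
      gcongr
      nlinarith
    simp only [norm_mul, norm_neg, Complex.norm_exp, Complex.norm_real, Real.norm_eq_abs,
      abs_of_nonneg ha]
    have e1 : (-q * c a).re = -q.re * c a := by simp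
    have e2 : (-((p.re / 4 : ℝ) : ℂ) * c a).re = -(p.re / 4) * c a := by
      rw [← ofReal_neg, ← ofReal_mul, ofReal_re]
    rw [e1, e2]
    calc ‖w a‖ * (Real.exp (-q.re * c a) * c a)
        ≤ ‖w a‖ * ((Real.exp (-(p.re / 4) * c a) * Real.exp (-(p.re / 4) * c a)) * c a) := by
          gcongr
      _ = (c a * Real.exp (-(p.re / 4) * c a)) * (‖w a‖ * Real.exp (-(p.re / 4) * c a)) := by ring
      _ ≤ _ := by gcongr
  · refine .of_forall fun a q _ ↦ ?_
    have : HasDerivAt (fun q : ℂ ↦ -q * c a) (-c a : ℂ) q := by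
      simpa using (hasDerivAt_id q).neg.mul_const (c a : ℂ)
    exact this.cexp.const_mul _

theorem eqOn_re_pos_of_eq_ofReal {f g : ℂ → ℂ} (hf : DifferentiableOn ℂ f {p | 0 < p.re})
    (hg : DifferentiableOn ℂ g {p | 0 < p.re}) (h : ∀ x : ℝ, 0 < x → f x = g x) :
    Set.EqOn f g {p | 0 < p.re} := by
  have hopen : IsOpen {p : ℂ | 0 < p.re} := isOpen_lt continuous_const Complex.continuous_re
  refine (hf.analyticOnNhd hopen).eqOn_of_preconnected_of_frequently_eq
    (hg.analyticOnNhd hopen) (convex_halfSpace_re_gt 0).isPreconnected (z₀ := 1) (by simp) ?_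
  have ht : Filter.Tendsto (fun x : ℝ ↦ (x : ℂ)) (nhdsWithin 1 (Set.Ioi 1)) (nhdsWithin 1 {1}ᶜ) := by
    refine tendsto_nhdsWithin_iff.2 ⟨?_, ?_⟩
    · exact (Complex.continuous_ofReal.tendsto' 1 1 (by simp)).mono_left nhdsWithin_le_nhds
    · filter_upwards [self_mem_nhdsWithin] with x hx
      simpa using (ne_of_gt hx)
  refine ht.frequently (Filter.Eventually.frequently ?_)
  filter_upwards [self_mem_nhdsWithin] with x hx
  exact h x (one_pos.trans hx)

theorem integral_exp_neg_sq_sub_div {a b : ℝ} (ha : 0 < a) (hb : 0 < b) :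
    ∫ u in Set.Ioi (0 : ℝ), Real.exp (-(a * u - b / u) ^ 2) = √Real.pi / (2 * a) := by
  set Φ : ℝ → ℝ := fun u ↦ a * u - b / u with hΦ
  have hd (u : ℝ) (hu : u ∈ Set.Ioi (0 : ℝ)) :
      HasDerivWithinAt Φ (a + b / u ^ 2) (Set.Ioi 0) u := by
    have hu : 0 < u := hu
    have := ((hasDerivAt_id u).const_mul a).sub ((hasDerivAt_inv hu.ne').const_mul b)
    refine (this.congr_deriv ?_).hasDerivWithinAt
    simp [div_eq_mul_inv]
  have hinj : Set.InjOn Φ (Set.Ioi 0) := by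
    refine StrictMonoOn.injOn fun x (hx : 0 < x) y hy hxy ↦ ?_
    have := div_lt_div_of_pos_left hb hx hxy
    have := mul_lt_mul_of_pos_left hxy ha
    simp only [hΦ]
    linarith
  have himg : Φ '' Set.Ioi 0 = Set.univ := by
    refine Set.eq_univ_of_forall fun x ↦ ?_
    have hs : √(x ^ 2 + 4 * a * b) ^ 2 = x ^ 2 + 4 * a * b := Real.sq_sqrt (by positivity)
    have hpos : 0 < x + √(x ^ 2 + 4 * a * b) := by
      have : |x| < √(x ^ 2 + 4 * a * b) := by
        rw [← Real.sqrt_sq_eq_abs]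
        exact Real.sqrt_lt_sqrt (sq_nonneg x) (by nlinarith [mul_pos ha hb])
      linarith [neg_abs_le x]
    refine ⟨(x + √(x ^ 2 + 4 * a * b)) / (2 * a), by simp only [Set.mem_Ioi]; positivity, ?_⟩
    simp only [hΦ]
    generalize √(x ^ 2 + 4 * a * b) = r at hs hpos
    field_simp
    linear_combination hs
  have habs (u : ℝ) : |a + b / u ^ 2| = a + b / u ^ 2 := abs_of_nonneg (by positivity)
  have hgauss : Integrable (fun x : ℝ ↦ Real.exp (-x ^ 2)) := by
    simpa using integrable_exp_neg_mul_sq one_pos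
  have hint : IntegrableOn (fun u ↦ (a + b / u ^ 2) * Real.exp (-Φ u ^ 2)) (Set.Ioi 0) := by
    have := (integrableOn_image_iff_integrableOn_abs_deriv_smul measurableSet_Ioi hd hinj
      (fun x ↦ Real.exp (-x ^ 2))).1 (by rw [himg]; exact hgauss.integrableOn)
    simpa only [habs, smul_eq_mul] using this
  have hval : ∫ u in Set.Ioi 0, (a + b / u ^ 2) * Real.exp (-Φ u ^ 2) = √Real.pi := by
    have := integral_image_eq_integral_abs_deriv_smul measurableSet_Ioi hd hinj
      (fun x ↦ Real.exp (-x ^ 2))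
    rw [himg, setIntegral_univ] at this
    simp only [habs, smul_eq_mul] at this
    rw [← this]
    simpa using integral_gaussian 1
  have hG : IntegrableOn (fun u ↦ Real.exp (-Φ u ^ 2)) (Set.Ioi 0) := by
    refine (hint.const_mul a⁻¹).mono' (by fun_prop) (.of_forall fun u ↦ ?_)
    rw [Real.norm_eq_abs, Real.abs_exp, ← mul_assoc]
    refine le_mul_of_one_le_left (Real.exp_pos _).le ?_
    rw [mul_add, inv_mul_cancel₀ ha.ne']
    have : 0 ≤ a⁻¹ * (b / u ^ 2) := by positivity
    linarith
  have hsymm : ∫ u in Set.Ioi 0, Real.exp (-Φ u ^ 2) =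
      ∫ u in Set.Ioi 0, (b / a / u ^ 2) * Real.exp (-Φ u ^ 2) := by
    have hd' (u : ℝ) (hu : u ∈ Set.Ioi (0 : ℝ)) :
        HasDerivWithinAt (fun u ↦ b / a * u⁻¹) (b / a * -(u ^ 2)⁻¹) (Set.Ioi 0) u :=
      ((hasDerivAt_inv (ne_of_gt hu)).const_mul (b / a)).hasDerivWithinAt
    have himg' : (fun u ↦ b / a * u⁻¹) '' Set.Ioi 0 = Set.Ioi 0 := by
      ext x
      constructor
      · rintro ⟨u, hu, rfl⟩
        have hu : 0 < u := hu
        simp only [Set.mem_Ioi]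
        positivity
      · intro hx
        have hx : 0 < x := hx
        exact ⟨b / a * x⁻¹, by simp only [Set.mem_Ioi]; positivity, by field_simp⟩
    have := integral_image_eq_integral_abs_deriv_smul measurableSet_Ioi hd'
      (fun x _ y _ h ↦ by simpa [hb.ne', ha.ne'] using h) (fun u ↦ Real.exp (-Φ u ^ 2))
    rw [himg'] at this
    rw [this]
    refine setIntegral_congr_fun measurableSet_Ioi fun u hu ↦ ?_
    have hu : 0 < u := hu
    have h1 : |b / a * -(u ^ 2)⁻¹| = b / a / u ^ 2 := by
      rw [mul_neg, abs_neg, abs_of_nonneg (by positivity), div_eq_mul_inv (b / a)]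
    have h2 : Φ (b / a * u⁻¹) = -Φ u := by
      simp only [hΦ]
      field_simp
      ring
    simp only [h1, h2, smul_eq_mul, neg_sq]
  have hsum : ∫ u in Set.Ioi 0, (b / u ^ 2) * Real.exp (-Φ u ^ 2) =
      √Real.pi - a * ∫ u in Set.Ioi 0, Real.exp (-Φ u ^ 2) := by
    rw [← hval, ← integral_const_mul, ← integral_sub hint (hG.const_mul a)]
    congr with u
    ring
  have hscale : ∫ u in Set.Ioi 0, (b / u ^ 2) * Real.exp (-Φ u ^ 2) =
      a * ∫ u in Set.Ioi 0, Real.exp (-Φ u ^ 2) := by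
    rw [hsymm, ← integral_const_mul]
    congr with u
    field_simp
  rw [eq_div_iff (by positivity)]
  linarith

theorem integral_inv_sqrt_mul_exp_neg_add_div {a b : ℝ} (ha : 0 < a) (hb : 0 < b) :
    ∫ t in Set.Ioi (0 : ℝ), (√(t * Real.pi))⁻¹ * Real.exp (-(a ^ 2 * t + b ^ 2 / t)) =
      Real.exp (-(2 * a * b)) / a := by
  rw [← integral_comp_rpow_Ioi_of_pos two_pos]
  have : ∀ u ∈ Set.Ioi (0 : ℝ), (2 * u ^ ((2 : ℝ) - 1)) •
      ((√(u ^ (2 : ℝ) * Real.pi))⁻¹ * Real.exp (-(a ^ 2 * u ^ (2 : ℝ) + b ^ 2 / u ^ (2 : ℝ)))) =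
      (2 / √Real.pi * Real.exp (-(2 * a * b))) * Real.exp (-(a * u - b / u) ^ 2) := by
    intro u hu
    have hu : 0 < u := hu
    have h1 : u ^ ((2 : ℝ) - 1) = u := by norm_num
    have hpi : 0 < √Real.pi := Real.sqrt_pos.2 Real.pi_pos
    rw [h1, Real.rpow_two, Real.sqrt_mul (sq_nonneg u), Real.sqrt_sq hu.le, smul_eq_mul,
      mul_assoc (2 / _), ← Real.exp_add]
    have h2 : -(2 * a * b) + -(a * u - b / u) ^ 2 = -(a ^ 2 * u ^ 2 + b ^ 2 / u ^ 2) := by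
      field_simp
      ring
    rw [h2]
    field_simp
  rw [setIntegral_congr_fun measurableSet_Ioi this, integral_const_mul,
    integral_exp_neg_sq_sub_div ha hb]
  have hpi : 0 < √Real.pi := Real.sqrt_pos.2 Real.pi_pos
  field_simp

theorem integrableOn_inv_sqrt_mul_cexp_mul_cexp {p q : ℂ} (hp : 0 < p.re) (hq : 0 ≤ q.re) :
    IntegrableOn (fun t : ℝ ↦ ((√(t * Real.pi))⁻¹ : ℝ) * cexp (-q * ((4 * t)⁻¹ : ℝ)) *
      cexp (-p * t)) (Set.Ioi 0) := by
  have hbase := (integrableOn_rpow_mul_exp_neg_mul_rpow (p := 1) (s := -(1 / 2)) (by norm_num)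
    one_pos hp).const_mul (√Real.pi)⁻¹
  refine hbase.mono' (by fun_prop) ?_
  filter_upwards [self_mem_ae_restrict measurableSet_Ioi] with t ht
  have ht : 0 < t := ht
  have e1 : (-q * ((4 * t)⁻¹ : ℝ)).re = -(q.re * (4 * t)⁻¹) := by
    rw [re_mul_ofReal, neg_re, neg_mul]
  have e2 : (-p * t).re = -p.re * t := by rw [re_mul_ofReal, neg_re]
  have e3 : t ^ (-(1 / 2) : ℝ) = (√t)⁻¹ := by rw [Real.rpow_neg ht.le, Real.sqrt_eq_rpow]
  have e4 : Real.exp (-(q.re * (4 * t)⁻¹)) ≤ 1 := by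
    rw [Real.exp_le_one_iff, neg_nonpos]
    positivity
  rw [norm_mul, norm_mul, Complex.norm_exp, Complex.norm_exp, e1, e2, e3, Complex.norm_real,
    Real.norm_of_nonneg (by positivity), Real.sqrt_mul ht.le, Real.rpow_one]
  calc (√t * √Real.pi)⁻¹ * Real.exp (-(q.re * (4 * t)⁻¹)) * Real.exp (-p.re * t)
      ≤ (√t * √Real.pi)⁻¹ * 1 * Real.exp (-p.re * t) := by gcongr
    _ = _ := by rw [mul_inv]; ring

theorem differentiableOn_cpow_half : DifferentiableOn ℂ (fun p : ℂ ↦ p ^ ((1 : ℂ) / 2))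
    {p | 0 < p.re} := fun p hp ↦
  ((differentiableAt_id (𝕜 := ℂ) (x := p)).cpow_const (.inl hp)).differentiableWithinAt

theorem ofReal_cpow_half {x : ℝ} (hx : 0 ≤ x) : (x : ℂ) ^ ((1 : ℂ) / 2) = (√x : ℝ) := by
  rw [Real.sqrt_eq_rpow, Complex.ofReal_cpow hx]
  norm_num

/-- The Laplace transform of the Gaussian kernel `t ↦ (tπ)^{-1/2} e^{-q/(4t)}`. -/
theorem integral_inv_sqrt_mul_cexp_mul_cexp {p q : ℂ} (hp : 0 < p.re) (hq : 0 < q.re) :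
    ∫ t in Set.Ioi (0 : ℝ), ((√(t * Real.pi))⁻¹ : ℝ) * cexp (-q * ((4 * t)⁻¹ : ℝ)) * cexp (-p * t)
      = cexp (-(p ^ ((1 : ℂ) / 2)) * q ^ ((1 : ℂ) / 2)) / p ^ ((1 : ℂ) / 2) := by
  have hpos : ∀ᵐ t ∂volume.restrict (Set.Ioi (0 : ℝ)), 0 ≤ t := by
    filter_upwards [self_mem_ae_restrict measurableSet_Ioi] with t ht using le_of_lt ht
  have hreal (y : ℝ) (hy : 0 < y) : Set.EqOn
      (fun p : ℂ ↦ ∫ t in Set.Ioi (0 : ℝ),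
        ((√(t * Real.pi))⁻¹ : ℝ) * cexp (-y * ((4 * t)⁻¹ : ℝ)) * cexp (-p * t))
      (fun p ↦ cexp (-(p ^ ((1 : ℂ) / 2)) * y ^ ((1 : ℂ) / 2)) / p ^ ((1 : ℂ) / 2))
      {p | 0 < p.re} := by
    refine eqOn_re_pos_of_eq_ofReal
      (differentiableOn_integral_mul_exp_neg_mul hpos (by fun_prop) fun ε hε ↦
        integrableOn_inv_sqrt_mul_cexp_mul_cexp (p := ε) (by simpa) (by simpa using hy.le)) ?_ ?_
    · refine (differentiableOn_cpow_half.neg.mul_const _).cexp.div differentiableOn_cpow_half ?_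
      rintro p hp
      have : p ≠ 0 := by rintro rfl; simp at hp
      simp [this]
    · intro x hx
      have := integral_inv_sqrt_mul_exp_neg_add_div (Real.sqrt_pos.2 hx)
        (half_pos (Real.sqrt_pos.2 hy))
      simp only [div_pow, Real.sq_sqrt hx.le, Real.sq_sqrt hy.le] at this
      simp only [ofReal_cpow_half hx.le, ofReal_cpow_half hy.le]
      have h := congrArg (fun r : ℝ ↦ (r : ℂ)) this
      simp only [← integral_complex_ofReal] at h
      convert h using 1
      · congr with t
        push_cast
        rw [mul_assoc, ← Complex.exp_add]
        congr 2
        ring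
      · push_cast
        congr 2
        ring
  have hw (ε : ℝ) (hε : 0 < ε) : Integrable (fun t : ℝ ↦ ((√(t * Real.pi))⁻¹ : ℝ) * cexp (-p * t) *
      cexp (-ε * ((4 * t)⁻¹ : ℝ))) (volume.restrict (Set.Ioi 0)) :=
    (integrableOn_inv_sqrt_mul_cexp_mul_cexp (q := ε) hp (by simpa using hε.le)).congr
      (.of_forall fun t ↦ mul_right_comm _ _ _)
  have key := eqOn_re_pos_of_eq_ofReal
    (differentiableOn_integral_mul_exp_neg_mul (c := fun t ↦ (4 * t)⁻¹)
      (hpos.mono fun t ht ↦ by positivity) (by fun_prop) hw)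
    (((differentiableOn_cpow_half.const_mul (-(p ^ ((1 : ℂ) / 2)))).cexp).div_const
      (p ^ ((1 : ℂ) / 2))) (fun y hy ↦ by
        simpa only [mul_right_comm] using! hreal y hy hp)
  simpa only [mul_right_comm] using! key hq

theorem integral_fourierInv_mul_fourier {f : ℝ → ℂ} (hf : Integrable f) (S : SchwartzMap ℝ ℂ) :
    ∫ ξ, FourierTransformInv.fourierInv (S : ℝ → ℂ) ξ * FourierTransform.fourier f ξ =
      ∫ t, f t * S t := by
  have h := VectorFourier.integral_fourierIntegral_smul_eq_flip (L := innerₗ ℝ)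
    Real.continuous_fourierChar continuous_inner hf
    (FourierTransformInv.fourierInv S : SchwartzMap ℝ ℂ).integrable (μ := volume) (ν := volume)
  rw [flip_innerₗ] at h
  have hS : FourierTransform.fourier ((FourierTransformInv.fourierInv S : SchwartzMap ℝ ℂ) : ℝ → ℂ)
      = S := by
    rw [← SchwartzMap.fourier_coe, FourierTransform.fourier_fourierInv_eq]
  rw [← SchwartzMap.fourierInv_coe]
  refine Eq.trans ?_ (h.trans ?_)
  · congr with ξ
    exact mul_comm _ _
  · congr with t
    exact congrArg (f t * ·) (congrFun hS t)

theorem re_sq_pos_of_abs_arg_lt {z : ℂ} (hz : z ≠ 0) (harg : |arg z| < Real.pi / 4) :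
    0 < (z ^ 2).re := by
  have h := abs_lt.1 harg
  have hcos : 0 < Real.cos (2 * arg z) := Real.cos_pos_of_mem_Ioo ⟨by linarith, by linarith⟩
  have hre : (z ^ 2).re = ‖z‖ ^ 2 * Real.cos (2 * arg z) := by
    rw [Real.cos_two_mul', mul_sub, ← mul_pow, ← mul_pow, norm_mul_cos_arg, norm_mul_sin_arg, sq z,
      mul_re]
    ring
  rw [hre]
  have := norm_pos_iff.2 hz
  positivity

/-- For `φ ∈ C_c^∞` supported in `[0,∞)`, `ā > 0` and `z` in the sector
`|arg z| < π/4`,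
`(-i) ∫_{ā-i∞}^{ā+i∞} φ̂(λ) e^{-√λ z}/√λ dλ = 2π ∫₀^∞ (tπ)^{-1/2} e^{-z²/4t} φ(t) dt`,
where the contour integral is `i ∫_ℝ (·)(ā+iy) dy` and `√` is the principal
square root. -/
theorem contour_gaussian_identity (φ : ℝ → ℂ) (hφ : ContDiff ℝ (⊤ : ℕ∞) φ)
    (hc : HasCompactSupport φ) (hsupp : tsupport φ ⊆ Set.Ici (0 : ℝ))
    (abar : ℝ) (ha : 0 < abar) (z : ℂ) (hz : z ≠ 0)
    (harg : |Complex.arg z| < Real.pi / 4) :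
    (-Complex.I) *
      (Complex.I * ∫ y : ℝ,
        (∫ τ : ℝ, Complex.exp ((abar + Complex.I * y) * τ) * φ τ) *
          Complex.exp (-((abar + Complex.I * y) ^ ((1 : ℂ) / 2)) * z) /
            (abar + Complex.I * y) ^ ((1 : ℂ) / 2))
      = 2 * Real.pi *
        ∫ t in Set.Ioi (0 : ℝ),
          ((Real.sqrt (t * Real.pi))⁻¹ : ℝ) * Complex.exp (-z ^ 2 / (4 * t)) * φ t := by
  have hq : 0 < (z ^ 2).re := re_sq_pos_of_abs_arg_lt hz harg
  have hzre : 0 < z.re := by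
    refine (abs_arg_lt_pi_div_two_iff.1 ?_).resolve_right hz
    linarith [Real.pi_pos]
  have hsqrt : (z ^ 2) ^ ((1 : ℂ) / 2) = z := by
    rw [one_div]
    exact sq_cpow_two_inv hzre
  have hψc : HasCompactSupport fun τ : ℝ ↦ cexp (abar * τ) * φ τ := hc.mul_left
  have hψ : ContDiff ℝ (⊤ : ℕ∞) fun τ : ℝ ↦ cexp (abar * τ) * φ τ :=
    (contDiff_const.mul ofRealCLM.contDiff).cexp.mul hφ
  set S : SchwartzMap ℝ ℂ := hψc.toSchwartzMap hψ with hS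
  set k : ℝ → ℂ := fun t ↦
    ((√(t * Real.pi))⁻¹ : ℝ) * cexp (-z ^ 2 * ((4 * t)⁻¹ : ℝ)) * cexp (-abar * t) with hk
  have hkint : IntegrableOn k (Set.Ioi 0) :=
    integrableOn_inv_sqrt_mul_cexp_mul_cexp (by simpa using ha) hq.le
  have hfourier (ξ : ℝ) : FourierTransform.fourier ((Set.Ioi 0).indicator k) ξ =
      cexp (-((abar + I * (2 * Real.pi * ξ : ℝ)) ^ ((1 : ℂ) / 2)) * z) /
        (abar + I * (2 * Real.pi * ξ : ℝ)) ^ ((1 : ℂ) / 2) := by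
    have hp : 0 < ((abar : ℂ) + I * (2 * Real.pi * ξ : ℝ)).re := by
      rw [add_re, re_mul_ofReal]
      simpa using ha
    have h := integral_inv_sqrt_mul_cexp_mul_cexp hp hq
    rw [hsqrt] at h
    rw [← h, Real.fourier_real_eq_integral_exp_smul, ← integral_indicator measurableSet_Ioi]
    congr with t
    by_cases ht : t ∈ Set.Ioi (0 : ℝ)
    · rw [Set.indicator_of_mem ht, Set.indicator_of_mem ht, smul_eq_mul]
      have hexp : cexp (-(abar + I * (2 * Real.pi * ξ : ℝ)) * t) =
          cexp (-abar * t) * cexp ((-2 * Real.pi * t * ξ : ℝ) * I) := by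
        rw [← Complex.exp_add]
        congr 1
        push_cast
        ring
      rw [hexp, hk]
      ring
    · simp [Set.indicator_of_notMem ht]
  have hfourierInv (ξ : ℝ) : FourierTransformInv.fourierInv (S : ℝ → ℂ) ξ =
      ∫ τ : ℝ, cexp ((abar + I * (2 * Real.pi * ξ : ℝ)) * τ) * φ τ := by
    rw [Real.fourierInv_eq']
    congr with τ
    rw [hS, HasCompactSupport.toSchwartzMap_toFun, smul_eq_mul, ← mul_assoc, ← Complex.exp_add]
    congr 2
    have hinner : inner ℝ τ ξ = ξ * τ := rfl
    rw [hinner]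
    push_cast
    ring
  have hparseval := integral_fourierInv_mul_fourier (hkint.integrable_indicator measurableSet_Ioi) S
  simp only [hfourier, hfourierInv, ← mul_div_assoc] at hparseval
  rw [Measure.integral_comp_mul_left (fun y : ℝ ↦
    (∫ τ : ℝ, cexp ((abar + I * y) * τ) * φ τ) * cexp (-((abar + I * y) ^ ((1 : ℂ) / 2)) * z) /
      (abar + I * y) ^ ((1 : ℂ) / 2)) (2 * Real.pi)] at hparseval
  have hpi : 0 < 2 * Real.pi := by positivity
  rw [abs_of_pos (inv_pos.2 hpi), inv_smul_eq_iff₀ hpi.ne'] at hparseval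
  rw [← mul_assoc, neg_mul, I_mul_I, neg_neg, one_mul, hparseval, real_smul,
    ← integral_indicator measurableSet_Ioi]
  push_cast
  congr 2 with t
  by_cases ht : t ∈ Set.Ioi (0 : ℝ)
  · rw [Set.indicator_of_mem ht, Set.indicator_of_mem ht, hS,
      HasCompactSupport.toSchwartzMap_toFun, hk]
    have h1 : cexp (-abar * t) * cexp (abar * t) = 1 := by
      rw [← Complex.exp_add]
      simp
    have h2 : -z ^ 2 * ((4 * t)⁻¹ : ℝ) = -z ^ 2 / (4 * t) := by
      push_cast
      rw [div_eq_mul_inv]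
    rw [← h2, ← ofReal_inv]
    linear_combination (((√(t * Real.pi))⁻¹ : ℝ) : ℂ) * cexp (-z ^ 2 * ((4 * t)⁻¹ : ℝ)) * φ t * h1
  · simp [Set.indicator_of_notMem ht]
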